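/- Let k be an algebraically closed field and let n ≥ 3 satisfy n ≢ 2 (mod 4). If X is a generating pattern on [n] whose GCD graph G_X is the n-cycle (distinct i and j adjacent if and only if j ≡ i ± 1 (mod n)), then V_X = k^n. -/

import Mathlib

open scoped Classical

noncomputable section

/-- A *generating pattern* on `[n]`: a finite set `X` of nonempty subsets of `Fin n`
such that for all `i ≠ j` there is `σ ∈ X` with `i ∈ σ` and `j ∉ σ`. -/
def IsGenPattern (n : ℕ) (X : Finset (Finset (Fin n))) : Prop :=
  (∀ σ ∈ X, σ.Nonempty) ∧ ∀ i j : Fin n, i ≠ j → ∃ σ ∈ X, i ∈ σ ∧ j ∉ σ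

/-- Adjacency in the GCD graph of a generating pattern. -/
def GcdAdj {n : ℕ} (X : Finset (Finset (Fin n))) (i j : Fin n) : Prop :=
  i ≠ j ∧ ∃ σ ∈ X, i ∈ σ ∧ j ∈ σ

/-- The neighborhood of a set of vertices in the GCD graph. -/
def Nbhd {n : ℕ} (X : Finset (Finset (Fin n))) (S : Finset (Fin n)) : Finset (Fin n) :=
  Finset.univ.filter fun j => ∃ i ∈ S, GcdAdj X i j

/-- The differential edge `d_{σ,i}` (from `σ ∪ {i}` to `σ`) exists. -/
def DiffEdge {n : ℕ} (X : Finset (Finset (Fin n))) (σ : Finset (Fin n)) (i : Fin n) : Prop :=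
  i ∉ σ ∧ ∀ τ ∈ X, i ∈ τ → (τ ∩ σ).Nonempty

/-- The homotopy edge `h_{σ,i}` (from `σ` to `σ ∪ {i}`) exists. -/
def HomEdge {n : ℕ} (X : Finset (Finset (Fin n))) (σ : Finset (Fin n)) (i : Fin n) : Prop :=
  i ∉ σ ∧ i ∉ Nbhd X σ

/-- `sign(σ, i) = (-1)^{|{j ∈ σ : j < i}|}`. -/
def edgeSign {n : ℕ} (σ : Finset (Fin n)) (i : Fin n) : ℤ :=
  (-1) ^ (σ.filter fun j => j < i).card

/-- The Taylor matrix of the generating pattern `X`, evaluated at the point `a : Fin n → k`. -/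
def taylorMatrixAt {n : ℕ} {k : Type*} [Field k] (X : Finset (Finset (Fin n)))
    (a : Fin n → k) : Matrix (Finset (Fin n)) (Finset (Fin n)) k :=
  fun r c =>
    (∑ i : Fin n, if c = insert i r ∧ DiffEdge X r i then (edgeSign r i : k) else 0) +
      ∑ i : Fin n, if r = insert i c ∧ HomEdge X c i then (edgeSign c i : k) * a i else 0

/-- The cohomological support variety `V_X ⊆ k^n`: the locus where all
`2^(n-1) × 2^(n-1)` minors of the Taylor matrix vanish. -/
def supportVariety {n : ℕ} (k : Type*) [Field k] (X : Finset (Finset (Fin n))) :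
    Set (Fin n → k) :=
  { a | ∀ f g : Fin (2 ^ (n - 1)) → Finset (Fin n),
      Function.Injective f → Function.Injective g →
      ((taylorMatrixAt X a).submatrix f g).det = 0 }

/-- The GCD graph of `X` is the `n`-cycle: distinct `i`, `j` are adjacent iff
`j ≡ i ± 1 (mod n)`. -/
def GcdGraphIsCycle (n : ℕ) [NeZero n] (X : Finset (Finset (Fin n))) : Prop :=
  ∀ i j : Fin n, GcdAdj X i j ↔ (j = i + 1 ∨ i = j + 1)


section LA
variable {k : Type*} [Field k] {V : Type*} [Fintype V]

theorem rank_add_le_aux (A B : Matrix V V k) : (A + B).rank ≤ A.rank + B.rank := by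
  unfold Matrix.rank
  rw [Matrix.mulVecLin_add]
  refine (Submodule.finrank_mono ?_).trans
    (Submodule.finrank_add_le_finrank_add_finrank A.mulVecLin.range B.mulVecLin.range)
  rintro _ ⟨x, rfl⟩
  exact Submodule.add_mem_sup ⟨x, rfl⟩ ⟨x, rfl⟩

theorem rank_bound_one (T : Matrix V V k) (hT : T * T = 0) (p : V → Prop)
    (hp : ∀ r c, T r c ≠ 0 → (p r ↔ ¬ p c)) :
    T.rank ≤ Fintype.card {v // p v} := by
  let iP : Matrix V {v // p v} k := (1 : Matrix V V k).submatrix id Subtype.val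
  let iQ : Matrix V {v // ¬ p v} k := (1 : Matrix V V k).submatrix id Subtype.val
  let A : Matrix {v // ¬ p v} {v // p v} k := T.submatrix Subtype.val Subtype.val
  let B : Matrix {v // p v} {v // ¬ p v} k := T.submatrix Subtype.val Subtype.val
  have hz : ∀ r c, (p r ↔ p c) → T r c = 0 := by
    intro r c h
    by_contra h0
    have := hp r c h0
    tauto
  have hAB : A * B = 0 := by
    ext r c
    have h1 : (T * T) r.1 c.1 = 0 := by rw [hT]; rfl
    rw [Matrix.mul_apply, ← Fintype.sum_subtype_add_sum_subtype p] at h1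
    have h2 : ∑ i : {x // ¬ p x}, T r.1 i.1 * T i.1 c.1 = 0 := by
      apply Finset.sum_eq_zero
      intro i _
      rw [hz r.1 i.1 (by have := i.2; have := r.2; tauto), zero_mul]
    rw [h2, add_zero] at h1
    rw [Matrix.mul_apply]
    exact h1
  have hdec : T = iQ * A * iP.transpose + iP * B * iQ.transpose := by
    ext r c
    simp only [Matrix.add_apply, Matrix.mul_apply, Matrix.transpose_apply, iP, iQ, A, B,
      Matrix.submatrix_apply, id, Matrix.one_apply]
    by_cases hr : p r <;> by_cases hc : p c
    · rw [hz r c (by tauto), Finset.sum_eq_zero, Finset.sum_eq_zero, add_zero]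
      · rintro ⟨x, hx⟩ _
        rw [if_neg (by rintro rfl; exact hx hc), mul_zero]
      · rintro ⟨x, hx⟩ _
        rw [Finset.sum_eq_zero, zero_mul]
        rintro ⟨y, hy⟩ _
        rw [if_neg (by rintro rfl; exact hy hr), zero_mul]
    · rw [Finset.sum_eq_zero, zero_add, Finset.sum_eq_single ⟨c, hc⟩, Finset.sum_eq_single ⟨r, hr⟩]
      · simp
      · rintro ⟨y, hy⟩ _ h
        rw [if_neg (by rintro rfl; exact h rfl), zero_mul]
      · simp
      · rintro ⟨y, hy⟩ _ h
        rw [if_neg (by rintro rfl; exact h rfl), mul_zero]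
      · simp
      · rintro ⟨x, hx⟩ _
        rw [if_neg (by rintro rfl; exact hc hx), mul_zero]
    · rw [add_comm, Finset.sum_eq_zero, zero_add, Finset.sum_eq_single ⟨c, hc⟩,
        Finset.sum_eq_single ⟨r, hr⟩]
      · simp
      · rintro ⟨y, hy⟩ _ h
        rw [if_neg (by rintro rfl; exact h rfl), zero_mul]
      · simp
      · rintro ⟨y, hy⟩ _ h
        rw [if_neg (by rintro rfl; exact h rfl), mul_zero]
      · simp
      · rintro ⟨x, hx⟩ _
        rw [if_neg (by rintro rfl; exact hx hc), mul_zero]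
    · rw [hz r c (by tauto), Finset.sum_eq_zero, Finset.sum_eq_zero, add_zero]
      · rintro ⟨x, hx⟩ _
        rw [Finset.sum_eq_zero, zero_mul]
        rintro ⟨y, hy⟩ _
        rw [if_neg (by rintro rfl; exact hr hy), zero_mul]
      · rintro ⟨x, hx⟩ _
        rw [if_neg (by rintro rfl; exact hc hx), mul_zero]
  have h1 : (iQ * A * iP.transpose).rank ≤ A.rank :=
    (Matrix.rank_mul_le_left _ _).trans (Matrix.rank_mul_le_right _ _)
  have h2 : (iP * B * iQ.transpose).rank ≤ B.rank :=
    (Matrix.rank_mul_le_left _ _).trans (Matrix.rank_mul_le_right _ _)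
  have h3 : A.rank + B.rank ≤ Fintype.card {v // p v} :=
    Matrix.rank_add_rank_le_card_of_mul_eq_zero hAB
  have h4 := rank_add_le_aux (iQ * A * iP.transpose) (iP * B * iQ.transpose)
  rw [← hdec] at h4
  omega

theorem minor_zero (T : Matrix V V k) (m : ℕ) (h : T.rank < m) (f g : Fin m → V) :
    (T.submatrix f g).det = 0 := by
  by_contra hd
  have h1 : (T.submatrix f g).rank = m := by
    rw [Matrix.rank_of_isUnit _ ((Matrix.isUnit_iff_isUnit_det _).2 (isUnit_iff_ne_zero.2 hd))]
    simp
  have h2 : T.submatrix f g = (1 : Matrix V V k).submatrix f id * T *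
      (1 : Matrix V V k).submatrix id g := by
    ext r c
    simp [Matrix.mul_apply, Matrix.one_apply]
  have h3 : (T.submatrix f g).rank ≤ T.rank := by
    rw [h2]
    exact (Matrix.rank_mul_le_left _ _).trans (Matrix.rank_mul_le_right _ _)
  omega

end LA

section Count

def wt (x y : Bool) : ℂ := if x = y then 1 else Complex.I

def pathSum : (m : ℕ) → Bool → Bool → ℂ := fun m z x =>
  ∑ b : Fin m → Bool, (∏ i : Fin m, wt ((Fin.cons x b : Fin (m+1) → Bool) i.castSucc) (b i)) *
    wt ((Fin.cons x b : Fin (m+1) → Bool) (Fin.last m)) z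

theorem pathSum_succ (m : ℕ) (z x : Bool) :
    pathSum (m+1) z x = ∑ y, wt x y * pathSum m z y := by
  unfold pathSum
  rw [← (Fin.consEquiv (fun _ : Fin (m+1) => Bool)).sum_comp, Fintype.sum_prod_type]
  refine Finset.sum_congr rfl fun y _ => ?_
  rw [Finset.mul_sum]
  refine Finset.sum_congr rfl fun b _ => ?_
  simp only [Fin.consEquiv, Equiv.coe_fn_mk]
  rw [Fin.prod_univ_succ, ← Fin.succ_last]
  simp only [Fin.cons_succ, Fin.cons_zero, Fin.castSucc_zero, ← Fin.succ_castSucc]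
  ring

theorem pathSum_eq (m : ℕ) : ∀ z x : Bool, pathSum m z x =
    ((1 + Complex.I)^(m+1) + (if x = z then 1 else -1) * (1 - Complex.I)^(m+1)) / 2 := by
  induction m with
  | zero =>
    intro z x
    simp only [pathSum, wt]
    cases x <;> cases z <;> simp <;> ring
  | succ m ih =>
    intro z x
    rw [pathSum_succ]
    simp only [Fintype.sum_bool, ih, wt]
    cases x <;> cases z <;> simp <;> ring

def uu (n : ℕ) [NeZero n] (c : Finset (Fin n)) : ℂ :=
  ∏ i : Fin n, wt (decide (i ∈ c)) (decide (i + 1 ∈ c))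

theorem sum_uu (n : ℕ) [NeZero n] :
    ∑ c, uu n c = (1 + Complex.I)^n + (1 - Complex.I)^n := by
  obtain ⟨m, rfl⟩ : ∃ m, n = m + 1 := ⟨n - 1, by have := NeZero.pos n; omega⟩
  have e : ∑ c, uu (m+1) c = ∑ b : Fin (m+1) → Bool, ∏ i, wt (b i) (b (i+1)) := by
    refine Fintype.sum_equiv (Equiv.ofBijective (fun c i => decide (i ∈ c)) ⟨?_, ?_⟩) _ _ ?_
    · intro c d h
      ext i
      have := congrFun h i
      simpa using this
    · intro b
      refine ⟨Finset.univ.filter fun i => b i = true, ?_⟩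
      ext i
      simp
    · intro c
      rfl
  rw [e, ← (Fin.consEquiv (fun _ : Fin (m+1) => Bool)).sum_comp, Fintype.sum_prod_type]
  have : ∀ x : Bool, ∑ b : Fin m → Bool, ∏ i : Fin (m+1),
      wt ((Fin.consEquiv (fun _ : Fin (m+1) => Bool)) (x, b) i)
        ((Fin.consEquiv (fun _ : Fin (m+1) => Bool)) (x, b) (i+1)) = pathSum m x x := by
    intro x
    unfold pathSum
    refine Finset.sum_congr rfl fun b _ => ?_
    rw [Fin.prod_univ_castSucc]
    simp only [Fin.consEquiv, Equiv.coe_fn_mk, Fin.coeSucc_eq_succ, Fin.cons_succ, Fin.last_add_one,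
      Fin.cons_zero]
  simp only [this, pathSum_eq, Fintype.sum_bool]
  simp
  

theorem sum_uu_ne (n : ℕ) [NeZero n] (h : n % 4 ≠ 2) : ∑ c, uu n c ≠ 0 := by
  rw [sum_uu]
  intro h0
  have h1 : (1 + Complex.I) = Complex.I * (1 - Complex.I) := by
    have := Complex.I_mul_I
    linear_combination this
  have hne : (1 - Complex.I) ≠ 0 := by
    intro h
    have := congrArg Complex.re h
    simp at this
  rw [h1, mul_pow] at h0
  have h2 : (Complex.I ^ n + 1) * (1 - Complex.I)^n = 0 := by linear_combination h0
  have h3 : Complex.I ^ n + 1 = 0 := by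
    rcases mul_eq_zero.1 h2 with h | h
    · exact h
    · exact absurd h (pow_ne_zero _ hne)
  rw [Complex.I_pow_eq_pow_mod] at h3
  have h4 : n % 4 < 4 := Nat.mod_lt _ (by norm_num)
  interval_cases n % 4
  · norm_num at h3
  · have := congrArg Complex.re h3
    simp at this
  · exact h rfl
  · have := congrArg Complex.re h3
    simp [pow_succ] at this

theorem uu_sq (n : ℕ) [NeZero n] (c : Finset (Fin n)) : uu n c = 1 ∨ uu n c = -1 := by
  rw [← sq_eq_one_iff]
  unfold uu
  rw [← Finset.prod_pow]
  let ε : Fin n → ℂ := fun i => if i ∈ c then 1 else -1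
  have h : ∀ i : Fin n, wt (decide (i ∈ c)) (decide (i + 1 ∈ c)) ^ 2 = ε i * ε (i+1) := by
    intro i
    simp only [wt, ε]
    by_cases h1 : i ∈ c <;> by_cases h2 : i + 1 ∈ c <;> simp [h1, h2]
  simp only [h]
  have hs : ∏ i, ε (i + 1) = ∏ i, ε i := Equiv.prod_comp (Equiv.addRight (1 : Fin n)) ε
  rw [Finset.prod_mul_distrib, hs, ← Finset.prod_mul_distrib]
  apply Finset.prod_eq_one
  intro i _
  simp only [ε]
  split_ifs <;> norm_num

end Count

section Main
set_option linter.unusedSectionVars false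
variable {n : ℕ} [NeZero n] {k : Type*} [Field k]

def flp (c : Finset (Fin n)) (i : Fin n) : Finset (Fin n) := symmDiff c {i}

theorem mem_flp (c : Finset (Fin n)) (i x : Fin n) :
    x ∈ flp c i ↔ ((x ∈ c ∧ x ≠ i) ∨ (x ∉ c ∧ x = i)) := by
  unfold flp
  rw [Finset.mem_symmDiff, Finset.mem_singleton]
  tauto

theorem mem_flp_self (c : Finset (Fin n)) (i : Fin n) : i ∈ flp c i ↔ i ∉ c := by
  rw [mem_flp]; tauto

theorem mem_flp_ne (c : Finset (Fin n)) (i x : Fin n) (h : x ≠ i) : x ∈ flp c i ↔ x ∈ c := by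
  rw [mem_flp]; tauto

theorem flp_comm (c : Finset (Fin n)) (i j : Fin n) : flp (flp c i) j = flp (flp c j) i := by
  unfold flp
  rw [symmDiff_assoc, symmDiff_assoc, symmDiff_comm ({i} : Finset (Fin n)) {j}]

def allIn (c : Finset (Fin n)) (i : Fin n) : Prop := i - 1 ∈ c ∧ i ∈ c ∧ i + 1 ∈ c
def noneIn (c : Finset (Fin n)) (i : Fin n) : Prop := i - 1 ∉ c ∧ i ∉ c ∧ i + 1 ∉ c

def qq (a b : Fin n → k) (c : Finset (Fin n)) (i : Fin n) : k :=
  if allIn c i then b i else if noneIn c i then a i else 0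

theorem qq_const (a b : Fin n → k) (c : Finset (Fin n)) (i : Fin n) (h : qq a b c i ≠ 0) :
    (i - 1 ∈ c ↔ i ∈ c) ∧ (i + 1 ∈ c ↔ i ∈ c) := by
  unfold qq allIn noneIn at h
  split_ifs at h <;> tauto

theorem succ_ne (hn : 3 ≤ n) (i : Fin n) : i + 1 ≠ i := by
  intro h
  have h1 : (1 : Fin n) = 0 := by simpa using h
  have := congrArg Fin.val h1
  rw [Fin.val_one', Fin.val_zero, Nat.mod_eq_of_lt (by omega)] at this
  omega

theorem pred_ne (hn : 3 ≤ n) (i : Fin n) : i - 1 ≠ i := by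
  intro h
  apply succ_ne hn (i - 1)
  rw [sub_add_cancel]; exact h.symm

theorem succ_ne_pred (hn : 3 ≤ n) (i : Fin n) : i + 1 ≠ i - 1 := by
  intro h
  have h1 : (1 : Fin n) + 1 = 0 := by
    have : i + (1 + 1) = i := by rw [← add_assoc, h, sub_add_cancel]
    simpa using this
  have := congrArg Fin.val h1
  rw [Fin.val_add, Fin.val_one', Fin.val_zero, Nat.mod_eq_of_lt (show 1 < n by omega),
    Nat.mod_eq_of_lt (by omega)] at this
  omega

theorem qq_adj (hn : 3 ≤ n) (a b : Fin n → k) (c : Finset (Fin n)) (i j : Fin n)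
    (h : j = i ∨ j = i + 1 ∨ i = j + 1) : qq a b c i * qq a b (flp c i) j = 0 := by
  by_contra h0
  obtain ⟨h1, h2⟩ := mul_ne_zero_iff.1 h0
  have h1 := qq_const _ _ _ _ h1
  have h2 := qq_const _ _ _ _ h2
  rcases h with rfl | rfl | rfl
  · have h2 := h2.2
    rw [mem_flp_self, mem_flp_ne _ _ _ (succ_ne hn _)] at h2
    tauto
  · have h2 := h2.1
    rw [add_sub_cancel_right, mem_flp_self, mem_flp_ne _ _ _ (succ_ne hn _)] at h2
    tauto
  · have h2 := h2.2
    rw [mem_flp_self, mem_flp_ne _ _ _ (succ_ne hn _).symm] at h2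
    rw [add_sub_cancel_right] at h1
    tauto

theorem qq_far (a b : Fin n → k) (c : Finset (Fin n)) (i j : Fin n)
    (h : ¬ (j = i ∨ j = i + 1 ∨ i = j + 1)) : qq a b (flp c i) j = qq a b c j := by
  push Not at h
  obtain ⟨h1, h2, h3⟩ := h
  unfold qq allIn noneIn
  rw [mem_flp_ne _ _ _ h1, mem_flp_ne _ _ _ h3.symm, mem_flp_ne c i (j - 1)]
  intro h; apply h2; rw [← h, sub_add_cancel]

theorem qq_comm (hn : 3 ≤ n) (a b : Fin n → k) (c : Finset (Fin n)) (i j : Fin n) :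
    qq a b c i * qq a b (flp c i) j = qq a b c j * qq a b (flp c j) i := by
  by_cases h : j = i ∨ j = i + 1 ∨ i = j + 1
  · rw [qq_adj hn _ _ _ _ _ h, qq_adj hn _ _ _ _ _ (by tauto)]
  · rw [qq_far _ _ _ _ _ h, qq_far _ _ _ _ _ (by tauto), mul_comm]

theorem sign_flp_of_le (c : Finset (Fin n)) (i j : Fin n) (h : j ≤ i) :
    edgeSign (flp c i) j = edgeSign c j := by
  unfold edgeSign
  congr 2
  ext x
  simp only [Finset.mem_filter]
  constructor
  · rintro ⟨h1, h2⟩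
    rw [mem_flp_ne _ _ _ (by omega)] at h1
    exact ⟨h1, h2⟩
  · rintro ⟨h1, h2⟩
    rw [mem_flp_ne _ _ _ (by omega)]
    exact ⟨h1, h2⟩

theorem sign_insert (c : Finset (Fin n)) (i j : Fin n) (h : i < j) (hi : i ∉ c) :
    edgeSign (insert i c) j = - edgeSign c j := by
  unfold edgeSign
  rw [Finset.filter_insert, if_pos h, Finset.card_insert_of_notMem (by simp [hi]), pow_succ]
  ring

theorem flp_of_notMem (c : Finset (Fin n)) (i : Fin n) (h : i ∉ c) : flp c i = insert i c := by
  ext x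
  rw [mem_flp, Finset.mem_insert]
  by_cases hx : x = i
  · subst hx; tauto
  · tauto

theorem flp_flp (c : Finset (Fin n)) (i : Fin n) : flp (flp c i) i = c := by
  unfold flp; rw [symmDiff_assoc, symmDiff_self]; simp

theorem sign_flp_of_lt (c : Finset (Fin n)) (i j : Fin n) (h : i < j) :
    edgeSign (flp c i) j = - edgeSign c j := by
  by_cases hi : i ∈ c
  · have h1 : i ∉ flp c i := by rw [mem_flp_self]; tauto
    have h2 := sign_insert (flp c i) i j h h1
    rw [← flp_of_notMem _ _ h1, flp_flp] at h2
    rw [h2, neg_neg]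
  · rw [flp_of_notMem _ _ hi, sign_insert _ _ _ h hi]

theorem sign_anti (c : Finset (Fin n)) (i j : Fin n) (h : i ≠ j) :
    edgeSign c i * edgeSign (flp c i) j = - (edgeSign c j * edgeSign (flp c j) i) := by
  rcases lt_or_gt_of_ne h with h | h
  · rw [sign_flp_of_lt _ _ _ h, sign_flp_of_le _ _ _ h.le]; ring
  · rw [sign_flp_of_lt _ _ _ h, sign_flp_of_le _ _ _ h.le]; ring

def tt (a b : Fin n → k) (c : Finset (Fin n)) (i : Fin n) : k :=
  (edgeSign c i : k) * qq a b c i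

def TM (a b : Fin n → k) : Matrix (Finset (Fin n)) (Finset (Fin n)) k :=
  fun r c => ∑ i, if r = flp c i then tt a b c i else 0

theorem tt_self (hn : 3 ≤ n) (a b : Fin n → k) (c : Finset (Fin n)) (i : Fin n) :
    tt a b c i * tt a b (flp c i) i = 0 := by
  have := qq_adj hn a b c i i (Or.inl rfl)
  unfold tt
  linear_combination (edgeSign c i : k) * (edgeSign (flp c i) i : k) * this

theorem tt_anti (hn : 3 ≤ n) (a b : Fin n → k) (c : Finset (Fin n)) (i j : Fin n) (h : i ≠ j) :
    tt a b c i * tt a b (flp c i) j + tt a b c j * tt a b (flp c j) i = 0 := by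
  have h1 := qq_comm hn a b c i j
  have h2 : (edgeSign c i : k) * (edgeSign (flp c i) j : k) =
      - ((edgeSign c j : k) * (edgeSign (flp c j) i : k)) := by
    exact_mod_cast congrArg (Int.cast : ℤ → k) (sign_anti c i j h)
  unfold tt
  linear_combination (edgeSign c i : k) * (edgeSign (flp c i) j : k) * h1 +
    qq a b c j * qq a b (flp c j) i * h2

theorem TM_sq (hn : 3 ≤ n) (a b : Fin n → k) : TM a b * TM a b = 0 := by
  ext r c
  rw [Matrix.mul_apply, Matrix.zero_apply]
  have h1 : ∑ m, TM a b r m * TM a b m c =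
      ∑ p : Fin n × Fin n, if r = flp (flp c p.1) p.2 then
        tt a b c p.1 * tt a b (flp c p.1) p.2 else 0 := by
    rw [Fintype.sum_prod_type]
    have h2 : ∀ m, TM a b r m * TM a b m c =
        ∑ i, if m = flp c i then TM a b r m * tt a b c i else 0 := by
      intro m
      rw [show TM a b m c = ∑ i, if m = flp c i then tt a b c i else 0 from rfl, Finset.mul_sum]
      refine Finset.sum_congr rfl fun i _ => ?_
      rw [mul_ite, mul_zero]
    simp only [h2]
    rw [Finset.sum_comm]
    refine Finset.sum_congr rfl fun i _ => ?_
    rw [Finset.sum_ite_eq' Finset.univ (flp c i), if_pos (Finset.mem_univ _)]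
    unfold TM
    rw [Finset.sum_mul]
    refine Finset.sum_congr rfl fun j _ => ?_
    rw [ite_mul, zero_mul, mul_comm]
  rw [h1]
  refine Finset.sum_involution (fun p _ => (p.2, p.1)) ?_ ?_ ?_ ?_
  · rintro ⟨i, j⟩ _
    dsimp only
    rw [flp_comm c j i]
    split_ifs with h
    · by_cases hij : i = j
      · subst hij
        rw [tt_self hn, add_zero]
      · exact tt_anti hn a b c i j hij
    · simp
  · rintro ⟨i, j⟩ _ h h2
    simp only [Prod.mk.injEq] at h2
    obtain ⟨rfl, _⟩ := h2
    dsimp only at h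
    rw [tt_self hn] at h
    simp at h
  · intros; simp
  · intros; rfl

theorem uu_flp (hn : 3 ≤ n) (c : Finset (Fin n)) (i : Fin n)
    (h : (i - 1 ∈ c ↔ i ∈ c) ∧ (i + 1 ∈ c ↔ i ∈ c)) : uu n (flp c i) = - uu n c := by
  obtain ⟨h1, h2⟩ := h
  have split : ∀ d, uu n d = wt (decide (i ∈ d)) (decide (i + 1 ∈ d)) *
      (wt (decide (i - 1 ∈ d)) (decide (i ∈ d)) *
      ∏ j ∈ (Finset.univ.erase i).erase (i - 1), wt (decide (j ∈ d)) (decide (j + 1 ∈ d))) := by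
    intro d
    unfold uu
    rw [← Finset.mul_prod_erase _ _ (Finset.mem_univ i),
      ← Finset.mul_prod_erase (Finset.univ.erase i) _
        (Finset.mem_erase.2 ⟨pred_ne hn i, Finset.mem_univ _⟩), sub_add_cancel]
  rw [split, split]
  have h3 : ∏ j ∈ (Finset.univ.erase i).erase (i - 1),
      wt (decide (j ∈ flp c i)) (decide (j + 1 ∈ flp c i)) =
      ∏ j ∈ (Finset.univ.erase i).erase (i - 1), wt (decide (j ∈ c)) (decide (j + 1 ∈ c)) := by
    refine Finset.prod_congr rfl fun j hj => ?_
    simp only [Finset.mem_erase] at hj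
    simp only [mem_flp_ne c i j hj.2.1, mem_flp_ne c i (j + 1)
      (by intro h; apply hj.1; rw [← h, add_sub_cancel_right])]
  rw [h3]
  simp only [mem_flp_self, mem_flp_ne c i _ (succ_ne hn i), mem_flp_ne c i _ (pred_ne hn i), h1, h2]
  have hI := Complex.I_mul_I
  by_cases hi : i ∈ c
  · simp only [wt, hi]
    simp
    rw [← mul_assoc, hI]; ring
  · simp only [wt, hi]
    simp
    rw [← mul_assoc, hI]; ring

theorem TM_uu (hn : 3 ≤ n) (a b : Fin n → k) (r c : Finset (Fin n)) (h : TM a b r c ≠ 0) :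
    uu n r = - uu n c := by
  obtain ⟨i, _, hi⟩ := Finset.exists_ne_zero_of_sum_ne_zero h
  split_ifs at hi with hr
  · rw [hr]
    apply uu_flp hn
    exact qq_const a b c i (right_ne_zero_of_mul hi)
  · exact absurd rfl hi

theorem diffEdge_iff (hn : 3 ≤ n) (X : Finset (Finset (Fin n))) (hX : IsGenPattern n X)
    (hcyc : GcdGraphIsCycle n X) (σ : Finset (Fin n)) (i : Fin n) :
    DiffEdge X σ i ↔ i ∉ σ ∧ i - 1 ∈ σ ∧ i + 1 ∈ σ ∧ {i} ∉ X := by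
  have nb : ∀ τ ∈ X, i ∈ τ → ∀ x ∈ τ, x ≠ i → x = i + 1 ∨ x = i - 1 := by
    intro τ hτ hi x hx hxi
    rcases (hcyc i x).1 ⟨hxi.symm, τ, hτ, hi, hx⟩ with h | h
    · exact Or.inl h
    · right; rw [h, add_sub_cancel_right]
  constructor
  · rintro ⟨h1, h2⟩
    refine ⟨h1, ?_, ?_, ?_⟩
    · obtain ⟨τ, hτ, hi, hj⟩ := hX.2 i (i + 1) (succ_ne hn i).symm
      obtain ⟨x, hx⟩ := h2 τ hτ hi
      rw [Finset.mem_inter] at hx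
      rcases nb τ hτ hi x hx.1 (by rintro rfl; exact h1 hx.2) with rfl | rfl
      · exact absurd hx.1 hj
      · exact hx.2
    · obtain ⟨τ, hτ, hi, hj⟩ := hX.2 i (i - 1) (pred_ne hn i).symm
      obtain ⟨x, hx⟩ := h2 τ hτ hi
      rw [Finset.mem_inter] at hx
      rcases nb τ hτ hi x hx.1 (by rintro rfl; exact h1 hx.2) with rfl | rfl
      · exact hx.2
      · exact absurd hx.1 hj
    · intro h
      obtain ⟨x, hx⟩ := h2 _ h (Finset.mem_singleton_self i)
      rw [Finset.mem_inter, Finset.mem_singleton] at hx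
      exact h1 (hx.1 ▸ hx.2)
  · rintro ⟨h1, h2, h3, h4⟩
    refine ⟨h1, fun τ hτ hi => ?_⟩
    have : ∃ x ∈ τ, x ≠ i := by
      by_contra! hall
      apply h4
      rwa [← Finset.eq_singleton_iff_unique_mem.2 ⟨hi, hall⟩]
    obtain ⟨x, hx, hxi⟩ := this
    refine ⟨x, Finset.mem_inter.2 ⟨hx, ?_⟩⟩
    rcases nb τ hτ hi x hx hxi with rfl | rfl <;> assumption

theorem homEdge_iff (X : Finset (Finset (Fin n)))
    (hcyc : GcdGraphIsCycle n X) (σ : Finset (Fin n)) (i : Fin n) :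
    HomEdge X σ i ↔ noneIn σ i := by
  unfold HomEdge noneIn Nbhd
  simp only [Finset.mem_filter, Finset.mem_univ, true_and, not_exists, not_and]
  constructor
  · rintro ⟨h1, h2⟩
    exact ⟨fun h => h2 _ h ((hcyc _ _).2 (Or.inl (sub_add_cancel i 1).symm)), h1,
      fun h => h2 _ h ((hcyc _ _).2 (Or.inr rfl))⟩
  · rintro ⟨h1, h2, h3⟩
    refine ⟨h2, fun x hx hadj => ?_⟩
    rcases (hcyc _ _).1 hadj with rfl | rfl
    · rw [add_sub_cancel_right] at h1; exact h1 hx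
    · exact h3 hx

theorem taylor_eq (hn : 3 ≤ n) (X : Finset (Finset (Fin n))) (hX : IsGenPattern n X)
    (hcyc : GcdGraphIsCycle n X) (a : Fin n → k) :
    taylorMatrixAt X a = TM a (fun i => if {i} ∈ X then 0 else 1) := by
  ext r c
  unfold taylorMatrixAt TM
  rw [← Finset.sum_add_distrib]
  refine Finset.sum_congr rfl fun i _ => ?_
  rw [diffEdge_iff hn X hX hcyc, homEdge_iff X hcyc]
  by_cases hr : r = flp c i
  · subst hr
    rw [if_pos rfl, sign_flp_of_le _ _ _ le_rfl, mem_flp_self, mem_flp_ne c i _ (succ_ne hn i),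
      mem_flp_ne c i _ (pred_ne hn i)]
    unfold tt qq
    by_cases hi : i ∈ c
    · have hc : c = insert i (flp c i) := by
        rw [← flp_of_notMem _ _ (by rw [mem_flp_self]; tauto), flp_flp]
      have hN : ¬ noneIn c i := fun h => h.2.1 hi
      rw [if_neg (c := _ ∧ noneIn c i) (fun h => hN h.2), add_zero, if_neg hN]
      by_cases hA : allIn c i
      · rw [if_pos hA]
        by_cases hs : {i} ∈ X
        · simp [hs]
        · rw [if_pos ⟨hc, by tauto, hA.1, hA.2.2, hs⟩]; simp [hs]
      · rw [if_neg hA, mul_zero, if_neg]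
        rintro ⟨_, _, h1, h2, _⟩
        exact hA ⟨h1, hi, h2⟩
    · rw [if_neg (fun h => h.2.1 hi), if_neg (fun h : allIn c i => hi h.2.1), zero_add]
      by_cases hN : noneIn c i
      · rw [if_pos ⟨flp_of_notMem _ _ hi, hN⟩, if_pos hN]
      · rw [if_neg (fun h => hN h.2), if_neg hN, mul_zero]
  · rw [if_neg hr, if_neg, if_neg, add_zero]
    · rintro ⟨h1, h2⟩
      exact hr (by rw [flp_of_notMem _ _ h2.2.1, h1])
    · rintro ⟨h1, h2, _⟩
      apply hr
      rw [h1, ← flp_of_notMem _ _ h2, flp_flp]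

theorem card_ne (h : n % 4 ≠ 2) :
    Fintype.card {c : Finset (Fin n) // uu n c = 1} ≠
      Fintype.card {c : Finset (Fin n) // ¬ uu n c = 1} := by
  intro he
  apply sum_uu_ne n h
  rw [← Fintype.sum_subtype_add_sum_subtype (fun c => uu n c = 1)]
  have h1 : ∑ c : {c : Finset (Fin n) // uu n c = 1}, uu n c.1 =
      Fintype.card {c : Finset (Fin n) // uu n c = 1} := by
    rw [Finset.sum_congr rfl (fun c _ => c.2)]; simp
  have h2 : ∑ c : {c : Finset (Fin n) // ¬ uu n c = 1}, uu n c.1 =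
      - Fintype.card {c : Finset (Fin n) // ¬ uu n c = 1} := by
    rw [Finset.sum_congr rfl (fun c _ => (uu_sq n c.1).resolve_left c.2)]; simp
  rw [h1, h2, he]; ring

theorem TM_rank (hn : 3 ≤ n) (h : n % 4 ≠ 2) (a b : Fin n → k) :
    (TM a b).rank < 2 ^ (n - 1) := by
  have key : ∀ r c, TM a b r c ≠ 0 → (uu n r = 1 ↔ ¬ uu n c = 1) := by
    intro r c h0
    have h1 := TM_uu hn a b r c h0
    rw [h1]
    rcases uu_sq n c with h2 | h2 <;> rw [h2] <;> norm_num
  have h1 := rank_bound_one (TM a b) (TM_sq hn a b) (fun c => uu n c = 1) key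
  have h2 : (TM a b).rank ≤ Fintype.card {c : Finset (Fin n) // ¬ uu n c = 1} := by
    convert rank_bound_one (TM a b) (TM_sq hn a b) (fun c => ¬ uu n c = 1)
      (fun r c h0 => by have := key r c h0; tauto)
  have h3 := card_ne (n := n) h
  have h4 : Fintype.card {c : Finset (Fin n) // ¬ uu n c = 1} = Fintype.card (Finset (Fin n)) -
      Fintype.card {c : Finset (Fin n) // uu n c = 1} := by
    convert Fintype.card_subtype_compl (fun c : Finset (Fin n) => uu n c = 1)
  have h5 := Fintype.card_subtype_le (fun c : Finset (Fin n) => uu n c = 1)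
  have h6 : Fintype.card (Finset (Fin n)) = 2 ^ (n - 1) * 2 := by
    rw [Fintype.card_finset, Fintype.card_fin, ← pow_succ]; congr 1; omega
  omega

end Main

theorem cycle_gcd_not_two_mod_four_full (k : Type*) [Field k] [IsAlgClosed k]
    (n : ℕ) [NeZero n] (hn : 3 ≤ n) (hmod : n % 4 ≠ 2)
    (X : Finset (Finset (Fin n))) (hX : IsGenPattern n X)
    (hcyc : GcdGraphIsCycle n X) :
    supportVariety k X = Set.univ := by
  ext a
  simp only [Set.mem_univ, iff_true]
  intro f g _ _
  apply minor_zero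
  rw [taylor_eq hn X hX hcyc]
  exact TM_rank hn hmod _ _
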